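/- Let σ₁, σ₂, σ₃, σ₄ ∈ ℂ[x, y, z, w] be the elementary symmetric polynomials in x, y, z, w, and for μ, ν ∈ ℂ define the S₄-symmetric septic F_{μ,ν} = (μ−ν)³ν(σ₁²σ₂σ₃ − σ₁σ₃² − σ₁³σ₄) − (μ+ν)ν³σ₁σ₂³ − (μ+ν)(μ³−ν³)σ₂²σ₃ + (μ+ν)(μ−ν)²(μ+2ν)σ₁σ₂σ₄ + (μ+ν)(μ−ν)³σ₃σ₄. Then there exist μ, ν ∈ ℂ such that the surface {F_{μ,ν} = 0} ⊂ ℙ³(ℂ) has exactly 16 singular points, each of which is an ordinary triple point, namely the four coordinate vertices and the twelve points of the orbit of (−ν : μ : ν : ν) under permutation of the coordinates. -/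

import Mathlib

open MvPolynomial

noncomputable section

/-- Iterated partial derivative of `f` along a list of variable indices. -/
def pderivList {n : ℕ} (l : List (Fin n)) (f : MvPolynomial (Fin n) ℂ) :
    MvPolynomial (Fin n) ℂ :=
  l.foldl (fun g i => MvPolynomial.pderiv i g) f

/-- All partial derivatives of `f` of order `< m` vanish at `p`
(`P` has multiplicity `≥ m` on `{f = 0}`). -/
def MultAtLeast {n : ℕ} (f : MvPolynomial (Fin n) ℂ) (p : Fin n → ℂ) (m : ℕ) : Prop :=
  ∀ l : List (Fin n), l.length < m → MvPolynomial.eval p (pderivList l f) = 0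

/-- `p` is (a representative of) a singular point of `{f = 0}`. -/
def SingularAt (f : MvPolynomial (Fin 4) ℂ) (p : Fin 4 → ℂ) : Prop :=
  MultAtLeast f p 2

/-- The partial derivatives of `c` have no common zero in `ℂⁿ ∖ {0}`. -/
def NowhereSingular {n : ℕ} (c : MvPolynomial (Fin n) ℂ) : Prop :=
  ∀ p : Fin n → ℂ, p ≠ 0 → ∃ i, MvPolynomial.eval p (MvPolynomial.pderiv i c) ≠ 0

/-- Linear change of coordinates: `substMatrix B f` is the polynomial `x ↦ f (B.mulVec x)`. -/
def substMatrix {n : ℕ} (B : Matrix (Fin n) (Fin n) ℂ) (f : MvPolynomial (Fin n) ℂ) :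
    MvPolynomial (Fin n) ℂ :=
  MvPolynomial.aeval (fun i => ∑ j, MvPolynomial.C (B i j) * MvPolynomial.X j) f

/-- `p` is (a representative of) an ordinary triple point of the degree-`d` surface `{f = 0}`:
all partials of order `≤ 2` vanish at `p`, some third-order partial does not, and after a
linear change of coordinates taking `(0,0,0,1)` to `p`, writing `f` as
`∑ⱼ x₃^(d-j) fⱼ(x₀,x₁,x₂)` with `fⱼ` homogeneous of degree `j`, the cubic `f₃` is nonsingular. -/
def OrdinaryTriplePointAt (d : ℕ) (f : MvPolynomial (Fin 4) ℂ) (p : Fin 4 → ℂ) : Prop :=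
  MultAtLeast f p 3 ∧
  (∃ l : List (Fin 4), l.length = 3 ∧ MvPolynomial.eval p (pderivList l f) ≠ 0) ∧
  ∃ B : Matrix (Fin 4) (Fin 4) ℂ, IsUnit B.det ∧ B.mulVec ![0, 0, 0, 1] = p ∧
    ∃ g : ℕ → MvPolynomial (Fin 3) ℂ,
      (∀ j, (g j).IsHomogeneous j) ∧
      substMatrix B f =
        ∑ j ∈ Finset.range (d + 1),
          (MvPolynomial.X 3) ^ (d - j) * MvPolynomial.rename Fin.castSucc (g j) ∧
      NowhereSingular (g 3)

/-- The set of singular points of `{f = 0}` in `ℙ³(ℂ)`. -/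
def SingSet (f : MvPolynomial (Fin 4) ℂ) : Set (Projectivization ℂ (Fin 4 → ℂ)) :=
  {P | SingularAt f P.rep}

/-- `{f = 0}` has `ν` ordinary triple points as its only singularities. -/
def OnlyTriplePoints (d ν : ℕ) (f : MvPolynomial (Fin 4) ℂ) : Prop :=
  (SingSet f).Finite ∧ (SingSet f).ncard = ν ∧
  ∀ P ∈ SingSet f, OrdinaryTriplePointAt d f P.rep

/-- The `S₄`-symmetric septic `F_{μ,ν}` of the paper, written in terms of the elementary
symmetric polynomials `σ₁, σ₂, σ₃, σ₄` of `x, y, z, w`. -/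
def septicFamily (μ ν : ℂ) : MvPolynomial (Fin 4) ℂ :=
  let σ₁ := MvPolynomial.esymm (Fin 4) ℂ 1
  let σ₂ := MvPolynomial.esymm (Fin 4) ℂ 2
  let σ₃ := MvPolynomial.esymm (Fin 4) ℂ 3
  let σ₄ := MvPolynomial.esymm (Fin 4) ℂ 4
  MvPolynomial.C ((μ - ν) ^ 3 * ν) * (σ₁ ^ 2 * σ₂ * σ₃ - σ₁ * σ₃ ^ 2 - σ₁ ^ 3 * σ₄)
    - MvPolynomial.C ((μ + ν) * ν ^ 3) * (σ₁ * σ₂ ^ 3)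
    - MvPolynomial.C ((μ + ν) * (μ ^ 3 - ν ^ 3)) * (σ₂ ^ 2 * σ₃)
    + MvPolynomial.C ((μ + ν) * (μ - ν) ^ 2 * (μ + 2 * ν)) * (σ₁ * σ₂ * σ₄)
    + MvPolynomial.C ((μ + ν) * (μ - ν) ^ 3) * (σ₃ * σ₄)

/-- For a point with coordinates `xᵢ` and elementary symmetric functions `sⱼ`, the `i`-th partial
derivative of `septicFamily 0 1` is the value at `t = xᵢ` of this polynomial, which is cubic in `t`;
its coefficients come from the derivatives of the septic with respect to the `sⱼ`. -/
def polarCubic (s₁ s₂ s₃ s₄ t : ℂ) : ℂ :=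
  (s₃ ^ 2 + 3 * s₁ ^ 2 * s₄ - 2 * s₁ * s₂ * s₃ - s₂ ^ 3 + 2 * s₂ * s₄)
    + (2 * s₂ * s₃ + 2 * s₁ * s₄ - s₁ ^ 2 * s₃ - 3 * s₁ * s₂ ^ 2) * (s₁ - t)
    + (2 * s₁ * s₃ + s₂ ^ 2 - s₁ ^ 2 * s₂ - s₄) * (s₂ - t * s₁ + t ^ 2)
    + (s₁ ^ 3 + 2 * s₁ * s₂ - s₃) * (s₃ - t * s₂ + t ^ 2 * s₁ - t ^ 3)

def polarAt (x y z w t : ℂ) : ℂ :=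
  polarCubic (x + y + z + w) (x * y + x * z + x * w + y * z + y * w + z * w)
    (x * y * z + x * y * w + x * z * w + y * z * w) (x * y * z * w) t

lemma coeffs_eq_zero_of_four_roots {K : Type*} [Field K] {a b c d x y z w : K}
    (hxy : x ≠ y) (hxz : x ≠ z) (hxw : x ≠ w) (hyz : y ≠ z) (hyw : y ≠ w) (hzw : z ≠ w)
    (hx : a + b * x + c * x ^ 2 + d * x ^ 3 = 0) (hy : a + b * y + c * y ^ 2 + d * y ^ 3 = 0)
    (hz : a + b * z + c * z ^ 2 + d * z ^ 3 = 0) (hw : a + b * w + c * w ^ 2 + d * w ^ 3 = 0) :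
    a = 0 ∧ b = 0 ∧ c = 0 ∧ d = 0 := by
  rw [← sub_ne_zero] at hxy hxz hxw hyz hyw hzw
  have h₁ : b + c * (x + y) + d * (x ^ 2 + x * y + y ^ 2) = 0 :=
    mul_left_cancel₀ hxy (by linear_combination hx - hy)
  have h₂ : b + c * (x + z) + d * (x ^ 2 + x * z + z ^ 2) = 0 :=
    mul_left_cancel₀ hxz (by linear_combination hx - hz)
  have h₃ : b + c * (x + w) + d * (x ^ 2 + x * w + w ^ 2) = 0 :=
    mul_left_cancel₀ hxw (by linear_combination hx - hw)
  have h₄ : c + d * (x + y + z) = 0 := mul_left_cancel₀ hyz (by linear_combination h₁ - h₂)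
  have h₅ : c + d * (x + y + w) = 0 := mul_left_cancel₀ hyw (by linear_combination h₁ - h₃)
  have hd : d = 0 := mul_left_cancel₀ hzw (by linear_combination h₄ - h₅)
  subst hd
  have hc : c = 0 := by linear_combination h₄
  subst hc
  have hb : b = 0 := by linear_combination h₁
  subst hb
  exact ⟨by linear_combination hx, rfl, rfl, rfl⟩

lemma not_four_distinct_polar_roots {x y z w : ℂ}
    (hxy : x ≠ y) (hxz : x ≠ z) (hxw : x ≠ w) (hyz : y ≠ z) (hyw : y ≠ w) (hzw : z ≠ w)
    (hx : polarAt x y z w x = 0) (hy : polarAt x y z w y = 0) (hz : polarAt x y z w z = 0)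
    (hw : polarAt x y z w w = 0) : False := by
  have root (t : ℂ) (ht : (t - x) * (t - y) * (t - z) * (t - w) = 0) :
      t ^ 4 - (x + y + z + w) * t ^ 3 + (x * y + x * z + x * w + y * z + y * w + z * w) * t ^ 2
        - (x * y * z + x * y * w + x * z * w + y * z * w) * t + x * y * z * w = 0 := by
    linear_combination ht
  have rx := root x (by ring)
  have ry := root y (by ring)
  have rz := root z (by ring)
  have r₄ := root w (by ring)
  unfold polarAt polarCubic at *
  generalize x + y + z + w = s₁ at *
  generalize x * y + x * z + x * w + y * z + y * w + z * w = s₂ at *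
  generalize x * y * z + x * y * w + x * z * w + y * z * w = s₃ at *
  generalize x * y * z * w = s₄ at *
  set a₁ := s₃ ^ 2 + 3 * s₁ ^ 2 * s₄ - 2 * s₁ * s₂ * s₃ - s₂ ^ 3 + 2 * s₂ * s₄ with ha₁
  set a₂ := 2 * s₂ * s₃ + 2 * s₁ * s₄ - s₁ ^ 2 * s₃ - 3 * s₁ * s₂ ^ 2 with ha₂
  set a₃ := 2 * s₁ * s₃ + s₂ ^ 2 - s₁ ^ 2 * s₂ - s₄ with ha₃
  set a₄ := s₁ ^ 3 + 2 * s₁ * s₂ - s₃ with ha₄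
  obtain ⟨h₀, h₁, h₂, h₃⟩ := coeffs_eq_zero_of_four_roots hxy hxz hxw hyz hyw hzw
    (a := a₁ + a₂ * s₁ + a₃ * s₂ + a₄ * s₃) (b := -(a₂ + a₃ * s₁ + a₄ * s₂))
    (c := a₃ + a₄ * s₁) (d := -a₄)
    (by linear_combination hx) (by linear_combination hy) (by linear_combination hz)
    (by linear_combination hw)
  have h₄ : a₄ = 0 := by linear_combination -h₃
  have h₃ : a₃ = 0 := by linear_combination h₂ - s₁ * h₄
  have h₂ : a₂ = 0 := by linear_combination -h₁ - s₁ * h₃ - s₂ * h₄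
  have h₁ : a₁ = 0 := by linear_combination h₀ - s₁ * h₂ - s₂ * h₃ - s₃ * h₄
  rw [h₄] at ha₄
  rw [h₃] at ha₃
  rw [h₂] at ha₂
  rw [h₁] at ha₁
  clear_value a₁ a₂ a₃ a₄
  clear * - hxy hxz hxw hyz hyw hzw rx ry rz r₄ ha₁ ha₂ ha₃ ha₄
  obtain rfl : s₃ = s₁ ^ 3 + 2 * s₁ * s₂ := by linear_combination ha₄
  obtain rfl : s₄ = 2 * s₁ ^ 4 + 3 * s₁ ^ 2 * s₂ + s₂ ^ 2 := by linear_combination ha₃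
  have hs : s₁ * (s₂ + s₁ ^ 2) ^ 2 = 0 := by linear_combination -ha₂ / 3
  rcases mul_eq_zero.mp hs with rfl | hs
  · have hs : s₂ = 0 := by
      refine pow_eq_zero_iff (n := 3) (by norm_num) |>.mp ?_
      linear_combination -ha₁
    subst hs
    have hx0 : x = 0 := pow_eq_zero_iff (n := 4) (by norm_num) |>.mp (by linear_combination rx)
    have hy0 : y = 0 := pow_eq_zero_iff (n := 4) (by norm_num) |>.mp (by linear_combination ry)
    exact hxy (hx0.trans hy0.symm)
  · obtain rfl : s₂ = -s₁ ^ 2 := by linear_combination pow_eq_zero_iff (by norm_num) |>.mp hs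
    have key (t : ℂ) (h : t ^ 4 - s₁ * t ^ 3 + -s₁ ^ 2 * t ^ 2
        - (s₁ ^ 3 + 2 * s₁ * -s₁ ^ 2) * t
        + (2 * s₁ ^ 4 + 3 * s₁ ^ 2 * -s₁ ^ 2 + (-s₁ ^ 2) ^ 2) = 0) :
        t = 0 ∨ t = s₁ ∨ t = -s₁ := by
      have : t * ((t - s₁) ^ 2 * (t + s₁)) = 0 := by linear_combination h
      simpa [sub_eq_zero, add_eq_zero_iff_eq_neg] using this
    have := key x rx
    have := key y ry
    have := key z rz
    have := key w r₄
    grind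

lemma polar_two_pairs {x z : ℂ} (hx : polarAt x x z z x = 0) (hz : polarAt x x z z z = 0) :
    x = 0 ∧ z = 0 := by
  unfold polarAt polarCubic at hx hz
  by_cases h : x = z
  · subst h
    have : x = 0 := pow_eq_zero_iff (n := 6) (by norm_num) |>.mp (by linear_combination hx / (-1631))
    exact ⟨this, this⟩
  have hq : (x + z) * (3 * (x + z) ^ 2 + x * z) * ((x + z) ^ 2 + x * z) = 0 :=
    mul_left_cancel₀ (sub_ne_zero.mpr h) (by linear_combination (hx - hz) / 3)
  have hc : 23 * (x + z) ^ 6 + 102 * (x + z) ^ 4 * (x * z) + 39 * (x + z) ^ 2 * (x * z) ^ 2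
      + 2 * (x * z) ^ 3 = 0 := by linear_combination -hx - hz
  clear hx hz
  have hs : x + z = 0 ∧ x * z = 0 := by
    generalize x + z = s at *
    generalize x * z = q at *
    rcases mul_eq_zero.mp hq with hq | hq
    · rcases mul_eq_zero.mp hq with rfl | hq
      · simpa using hc
      · obtain rfl : q = -3 * s ^ 2 := by linear_combination hq
        have : s = 0 := pow_eq_zero_iff (n := 6) (by norm_num) |>.mp (by linear_combination hc / 14)
        simp [this]
    · obtain rfl : q = -s ^ 2 := by linear_combination hq
      have : s = 0 := pow_eq_zero_iff (n := 6) (by norm_num) |>.mp (by linear_combination -hc / 42)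
      simp [this]
  grind

lemma polar_one_pair {x z w : ℂ} (hzw : z ≠ w) (hx : polarAt x x z w x = 0)
    (hz : polarAt x x z w z = 0) (hw : polarAt x x z w w = 0) :
    z * w = 0 ∧ (x = 0 ∨ x + z + w = 0) := by
  unfold polarAt polarCubic at hx hz hw
  obtain ⟨u, hu⟩ : ∃ u, u = x + z + w := ⟨_, rfl⟩
  obtain ⟨p, hp⟩ : ∃ p, p = z * w := ⟨_, rfl⟩
  have h₁ : 12 * x ^ 4 * u ^ 2 - 4 * x ^ 3 * u ^ 3 + 16 * x ^ 3 * u * p - 15 * x ^ 2 * u ^ 4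
      + 4 * x ^ 2 * p ^ 2 - 16 * x * u ^ 3 * p - 4 * u ^ 2 * p ^ 2 = 0 := by
    subst hu hp; linear_combination hx
  have h₂ : (x - u) * (4 * x * u + 3 * p) * (4 * x * u + p) = 0 := by
    subst hu hp
    exact mul_left_cancel₀ (sub_ne_zero.mpr hzw) (by linear_combination hw - hz)
  have h₃ : 24 * x ^ 4 * u ^ 2 - 40 * x ^ 3 * u ^ 3 + 32 * x ^ 3 * u * p - 48 * x ^ 2 * u ^ 2 * p
      + 8 * x ^ 2 * p ^ 2 - 16 * x * u * p ^ 2 - p ^ 3 = 0 := by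
    subst hu hp
    linear_combination hz - w * h₂
  rw [← hu, ← hp]
  clear hx hz hw hu hp hzw
  by_cases hx0 : x = 0
  · subst hx0
    exact ⟨pow_eq_zero_iff (n := 3) (by norm_num) |>.mp (by linear_combination -h₃), .inl rfl⟩
  have hu0 : u = 0 := by
    by_contra hu0
    rcases mul_eq_zero.mp h₂ with h₂ | h₂
    · rcases mul_eq_zero.mp h₂ with h₂ | h₂
      · obtain rfl : u = x := by linear_combination -h₂
        exact hx0 (pow_eq_zero_iff (n := 6) (by norm_num) |>.mp (by linear_combination -h₁ / 7))
      · obtain rfl : p = -4 / 3 * x * u := by linear_combination h₂ / 3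
        have h₄ : 15 * x + 7 * u = 0 := by
          refine mul_left_cancel₀ (mul_ne_zero (pow_ne_zero 3 hx0) (pow_ne_zero 2 hu0)) ?_
          linear_combination -27 / 8 * h₃
        obtain rfl : u = -15 / 7 * x := by linear_combination h₄ / 7
        exact hx0 (pow_eq_zero_iff (n := 6) (by norm_num) |>.mp
          (by linear_combination 49 * 9 / (25 * 225) * h₁))
    · obtain rfl : p = -4 * x * u := by linear_combination h₂
      have h₄ : 3 * x - 5 * u = 0 := by
        refine mul_left_cancel₀ (mul_ne_zero (pow_ne_zero 3 hx0) (pow_ne_zero 2 hu0)) ?_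
        linear_combination h₃ / 8
      obtain rfl : u = 3 / 5 * x := by linear_combination -h₄ / 5
      exact hx0 (pow_eq_zero_iff (n := 6) (by norm_num) |>.mp (by linear_combination 125 / 189 * h₁))
  subst hu0
  refine ⟨?_, .inr rfl⟩
  have : x * p = 0 := pow_eq_zero_iff (n := 2) (by norm_num) |>.mp (by linear_combination h₁ / 4)
  exact (mul_eq_zero.mp this).resolve_left hx0

lemma isHomogeneous_esymm (σ R : Type*) [Fintype σ] [CommRing R] (n : ℕ) :
    (esymm σ R n).IsHomogeneous n := by
  refine IsHomogeneous.sum _ _ _ fun t ht => ?_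
  have := IsHomogeneous.prod t (fun i => (X i : MvPolynomial σ R)) (fun _ => 1)
    fun i _ => isHomogeneous_X R i
  simpa [(Finset.mem_powersetCard.mp ht).2] using this

lemma isHomogeneous_septicFamily (μ ν : ℂ) : (septicFamily μ ν).IsHomogeneous 7 := by
  have h₁ := isHomogeneous_esymm (Fin 4) ℂ 1
  have h₂ := isHomogeneous_esymm (Fin 4) ℂ 2
  have h₃ := isHomogeneous_esymm (Fin 4) ℂ 3
  have h₄ := isHomogeneous_esymm (Fin 4) ℂ 4
  exact (((((((h₁.pow 2).mul h₂).mul h₃).sub (h₁.mul (h₃.pow 2))).sub ((h₁.pow 3).mul h₄)).C_mul _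
    |>.sub ((h₁.mul (h₂.pow 3)).C_mul _)).sub (((h₂.pow 2).mul h₃).C_mul _)).add
    (((h₁.mul h₂).mul h₄).C_mul _) |>.add ((h₃.mul h₄).C_mul _)

lemma rename_septicFamily (e : Equiv.Perm (Fin 4)) (μ ν : ℂ) :
    rename e (septicFamily μ ν) = septicFamily μ ν := by
  simp [septicFamily, -esymm_one, rename_esymm]

lemma esymm_fin_four (R : Type*) [CommRing R] :
    esymm (Fin 4) R 1 = X 0 + X 1 + X 2 + X 3 ∧
    esymm (Fin 4) R 2 = X 0 * X 1 + X 0 * X 2 + X 0 * X 3 + X 1 * X 2 + X 1 * X 3 + X 2 * X 3 ∧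
    esymm (Fin 4) R 3 = X 0 * X 1 * X 2 + X 0 * X 1 * X 3 + X 0 * X 2 * X 3 + X 1 * X 2 * X 3 ∧
    esymm (Fin 4) R 4 = X 0 * X 1 * X 2 * X 3 := by
  have h₂ : Finset.powersetCard 2 (Finset.univ : Finset (Fin 4)) =
      {{0, 1}, {0, 2}, {0, 3}, {1, 2}, {1, 3}, {2, 3}} := by decide
  have h₃ : Finset.powersetCard 3 (Finset.univ : Finset (Fin 4)) =
      {{0, 1, 2}, {0, 1, 3}, {0, 2, 3}, {1, 2, 3}} := by decide
  have h₄ : Finset.powersetCard 4 (Finset.univ : Finset (Fin 4)) = {{0, 1, 2, 3}} := by decide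
  refine ⟨?_, ?_, ?_, ?_⟩
  · simp [esymm_one, Fin.sum_univ_four]
  · rw [esymm, h₂]
    repeat rw [Finset.sum_insert (by decide)]
    simp; ring
  · rw [esymm, h₃]
    repeat rw [Finset.sum_insert (by decide)]
    simp; ring
  · rw [esymm, h₄]
    simp; ring

lemma pderivList_rename (e : Equiv.Perm (Fin 4)) (l : List (Fin 4)) (f : MvPolynomial (Fin 4) ℂ) :
    pderivList (l.map e) (rename e f) = rename e (pderivList l f) := by
  induction l generalizing f with
  | nil => rfl
  | cons i l ih =>
    simpa [pderivList, pderiv_rename e.injective] using ih (pderiv i f)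

lemma isHomogeneous_pderivList {n d : ℕ} {f : MvPolynomial (Fin n) ℂ} (hf : f.IsHomogeneous d)
    (l : List (Fin n)) : (pderivList l f).IsHomogeneous (d - l.length) := by
  induction l generalizing f d with
  | nil => exact hf
  | cons i l ih =>
    have := ih (hf.pderiv (i := i))
    rwa [Nat.sub_sub, add_comm 1] at this

lemma aeval_smul_of_isHomogeneous {A : Type*} [CommRing A] [Algebra ℂ A] {n d : ℕ}
    {f : MvPolynomial (Fin n) ℂ} (hf : f.IsHomogeneous d) (c : ℂ) (v : Fin n → A) :
    aeval (c • v) f = c ^ d • aeval v f := by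
  rw [aeval_def, aeval_def, eval₂_eq', eval₂_eq', Finset.smul_sum]
  refine Finset.sum_congr rfl fun m hm => ?_
  have hd : ∑ i, m i = d := by
    rw [← hf (mem_support_iff.mp hm), ← Finsupp.degree_eq_sum]
    rw [Finsupp.degree_eq_weight_one]
    rfl
  simp only [Pi.smul_apply, smul_pow, Finset.prod_smul, Finset.prod_pow_eq_pow_sum, hd,
    mul_smul_comm]

lemma eval_pderiv_septicFamily (v : Fin 4 → ℂ) (i : Fin 4) :
    eval v (pderiv i (septicFamily 0 1)) = polarAt (v 0) (v 1) (v 2) (v 3) (v i) := by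
  obtain ⟨h₁, h₂, h₃, h₄⟩ := esymm_fin_four ℂ
  rw [septicFamily, h₁, h₂, h₃, h₄, polarAt, polarCubic]
  fin_cases i <;> simp [Derivation.leibniz, Derivation.leibniz_pow, pderiv_X] <;> ring

lemma aeval_septicFamily {A : Type*} [CommRing A] [Algebra ℂ A] (g : Fin 4 → A) {s₁ s₂ s₃ s₄ : A}
    (h₁ : s₁ = g 0 + g 1 + g 2 + g 3)
    (h₂ : s₂ = g 0 * g 1 + g 0 * g 2 + g 0 * g 3 + g 1 * g 2 + g 1 * g 3 + g 2 * g 3)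
    (h₃ : s₃ = g 0 * g 1 * g 2 + g 0 * g 1 * g 3 + g 0 * g 2 * g 3 + g 1 * g 2 * g 3)
    (h₄ : s₄ = g 0 * g 1 * g 2 * g 3) :
    aeval g (septicFamily 0 1) =
      s₁ * s₃ ^ 2 + s₁ ^ 3 * s₄ - s₁ ^ 2 * s₂ * s₃ - s₁ * s₂ ^ 3 + s₂ ^ 2 * s₃
        + 2 * s₁ * s₂ * s₄ - s₃ * s₄ := by
  obtain ⟨e₁, e₂, e₃, e₄⟩ := esymm_fin_four ℂ
  rw [septicFamily, e₁, e₂, e₃, e₄, h₁, h₂, h₃, h₄]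
  simp only [map_add, map_sub, map_mul, map_pow, aeval_X, map_zero, map_one, map_ofNat]
  ring

lemma eval_comp_pderivList {e : Equiv.Perm (Fin 4)} {f : MvPolynomial (Fin 4) ℂ}
    (hf : rename e f = f) (p : Fin 4 → ℂ) (l : List (Fin 4)) :
    eval (p ∘ e) (pderivList l f) = eval p (pderivList (l.map e) f) := by
  rw [← eval_rename, ← pderivList_rename, hf]

lemma MultAtLeast.comp_perm {e : Equiv.Perm (Fin 4)} {f : MvPolynomial (Fin 4) ℂ} {m : ℕ}
    {p : Fin 4 → ℂ} (hf : rename e f = f) (h : MultAtLeast f p m) : MultAtLeast f (p ∘ e) m :=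
  fun l hl => by
    rw [eval_comp_pderivList hf]
    exact h _ (by simpa using hl)

lemma OrdinaryTriplePointAt.comp_perm {e : Equiv.Perm (Fin 4)} {f : MvPolynomial (Fin 4) ℂ}
    {d : ℕ} {p : Fin 4 → ℂ} (hf : rename e f = f) (h : OrdinaryTriplePointAt d f p) :
    OrdinaryTriplePointAt d f (p ∘ e) := by
  obtain ⟨hm, ⟨l, hl, hlf⟩, B, hB, hBp, g, hg, hgf, hg₃⟩ := h
  refine ⟨hm.comp_perm hf, ⟨l.map e.symm, by simpa using hl, ?_⟩, B.submatrix e id, ?_, ?_, g, hg,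
    ?_, hg₃⟩
  · rw [eval_comp_pderivList hf]
    simpa using hlf
  · rw [Matrix.det_permute]
    exact (((Equiv.Perm.sign e).isUnit.map (Int.castRingHom ℂ))).mul hB
  · rw [← hBp]
    rfl
  · rw [← hgf]
    nth_rw 2 [← hf]
    rw [substMatrix, substMatrix, aeval_rename]
    rfl

lemma eval_smul_pderivList {f : MvPolynomial (Fin 4) ℂ} {d : ℕ} (hf : f.IsHomogeneous d) (c : ℂ)
    (p : Fin 4 → ℂ) (l : List (Fin 4)) :
    eval (c • p) (pderivList l f) = c ^ (d - l.length) * eval p (pderivList l f) := by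
  simpa [aeval_eq_eval] using aeval_smul_of_isHomogeneous (isHomogeneous_pderivList hf l) c p

lemma OrdinaryTriplePointAt.smul {f : MvPolynomial (Fin 4) ℂ} {d : ℕ} {p : Fin 4 → ℂ} {c : ℂ}
    (hc : c ≠ 0) (hf : f.IsHomogeneous d) (h : OrdinaryTriplePointAt d f p) :
    OrdinaryTriplePointAt d f (c • p) := by
  obtain ⟨hm, ⟨l, hl, hlf⟩, B, hB, hBp, g, hg, hgf, hg₃⟩ := h
  refine ⟨fun l hl => ?_, ⟨l, hl, ?_⟩, c • B, ?_, ?_, fun j => C (c ^ d) * g j,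
    fun j => (hg j).C_mul _, ?_, fun q hq => ?_⟩
  · rw [eval_smul_pderivList hf, hm l hl, mul_zero]
  · rw [eval_smul_pderivList hf]
    exact mul_ne_zero (pow_ne_zero _ hc) hlf
  · rw [Matrix.det_smul]
    exact ((isUnit_iff_ne_zero.mpr hc).pow _).mul hB
  · rw [Matrix.smul_mulVec, hBp]
  · calc substMatrix (c • B) f = c ^ d • substMatrix B f := by
          rw [substMatrix, substMatrix, ← aeval_smul_of_isHomogeneous hf]
          congr 2
          ext1 i
          simp [Finset.smul_sum, smul_eq_C_mul, mul_assoc]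
      _ = _ := by
          rw [hgf, Finset.smul_sum]
          refine Finset.sum_congr rfl fun j _ => ?_
          rw [map_mul, rename_C, smul_eq_C_mul]
          ring
  · obtain ⟨i, hi⟩ := hg₃ q hq
    refine ⟨i, ?_⟩
    rw [pderiv_C_mul, map_mul, eval_C]
    exact mul_ne_zero (pow_ne_zero _ hc) hi

lemma Ideal.derivation_mem_pow {A : Type*} [CommRing A] [Algebra ℂ A] (D : Derivation ℂ A A)
    (I : Ideal A) {m : ℕ} {f : A} (hf : f ∈ I ^ (m + 1)) : D f ∈ I ^ m := by
  induction m generalizing f with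
  | zero => simp
  | succ m ih =>
    rw [pow_succ] at hf
    induction hf using Submodule.mul_induction_on' with
    | mem_mul_mem a ha b hb =>
      rw [Derivation.leibniz, smul_eq_mul, smul_eq_mul]
      refine Ideal.add_mem _ (Ideal.mul_mem_right _ _ ha) ?_
      rw [pow_succ']
      exact Ideal.mul_mem_mul hb (ih ha)
    | add a _ b _ ha hb => rw [map_add]; exact Ideal.add_mem _ ha hb

lemma multAtLeast_of_mem_pow {n m : ℕ} {f : MvPolynomial (Fin n) ℂ} {p : Fin n → ℂ}
    (hf : f ∈ RingHom.ker (eval p) ^ m) : MultAtLeast f p m := by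
  intro l hl
  induction l generalizing f m with
  | nil =>
    exact Ideal.pow_le_self (by simpa using hl.ne') hf
  | cons i l ih =>
    obtain ⟨m, rfl⟩ := Nat.exists_eq_add_one_of_ne_zero (by omega : m ≠ 0)
    exact ih (Ideal.derivation_mem_pow (pderiv i) _ hf) (by simpa using hl)

/-- The homogeneous parts of `septicFamily 0 1` at the vertex `(0 : 0 : 0 : 1)`. -/
def vertexForm : ℕ → MvPolynomial (Fin 3) ℂ :=
  let e₁ := X 0 + X 1 + X 2
  let e₂ := X 0 * X 1 + X 0 * X 2 + X 1 * X 2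
  let e₃ := X 0 * X 1 * X 2
  let d := e₃ - e₁ * e₂
  fun
  | 3 => d - e₁ ^ 3
  | 4 => e₁ * (C 4 * d - e₁ ^ 3)
  | 5 => (C 4 * e₁ ^ 2 + C 2 * e₂) * d
  | 6 => C 4 * (e₁ * e₂) * d
  | 7 => (e₁ * e₃ + e₂ ^ 2) * d
  | _ => 0

lemma isHomogeneous_vertexForm (j : ℕ) : (vertexForm j).IsHomogeneous j := by
  have h (i : Fin 3) := isHomogeneous_X ℂ i
  have h₁ := ((h 0).add (h 1)).add (h 2)
  have h₂ := (((h 0).mul (h 1)).add ((h 0).mul (h 2))).add ((h 1).mul (h 2))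
  have h₃ := ((h 0).mul (h 1)).mul (h 2)
  have hd := h₃.sub (h₁.mul h₂)
  match j with
  | 0 | 1 | 2 | _ + 8 => exact isHomogeneous_zero ..
  | 3 => exact hd.sub (h₁.pow 3)
  | 4 => exact h₁.mul ((hd.C_mul 4).sub (h₁.pow 3))
  | 5 => exact (((h₁.pow 2).C_mul 4).add (h₂.C_mul 2)).mul hd
  | 6 => exact ((h₁.mul h₂).C_mul 4).mul hd
  | 7 => exact ((h₁.mul h₃).add (h₂.pow 2)).mul hd

lemma nowhereSingular_vertexForm : NowhereSingular (vertexForm 3) := by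
  intro p hp
  by_contra! h
  have h₀ := h 0
  have h₁ := h 1
  have h₂ := h 2
  simp [vertexForm, Derivation.leibniz, Derivation.leibniz_pow, pderiv_X] at h₀ h₁ h₂
  have h₀₁ : (p 0 + p 1) * (p 1 - p 0) = 0 := by linear_combination h₁ - h₀
  have h₀₂ : (p 0 + p 2) * (p 2 - p 0) = 0 := by linear_combination h₂ - h₀
  have hp₀ : p 0 = 0 := by
    rcases mul_eq_zero.mp h₀₁ with e₁ | e₁ <;> rcases mul_eq_zero.mp h₀₂ with e₂ | e₂ <;> grind
  refine hp (funext fun i => ?_)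
  fin_cases i <;> simp_all

/-- Monomials in the symmetric functions `a + b`, `ab` and in `c`, for the coordinates `a, b, c` of
`ℙ³` at the point `(1 : 1 : 0 : -1)`, which swapping `x` and `y` fixes. -/
def nodeTerm (a : ℂ) (i j k : ℕ) : MvPolynomial (Fin 3) ℂ :=
  C a * ((X 0 + X 1) ^ i * (X 0 * X 1) ^ j * X 2 ^ k)

/-- The homogeneous parts of `septicFamily 0 1` at `(1 : 1 : 0 : -1)`. -/
def nodeForm : ℕ → MvPolynomial (Fin 3) ℂ
  | 3 => nodeTerm 4 1 1 0 + nodeTerm 8 0 1 1 + nodeTerm (-1) 0 0 3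
  | 4 => nodeTerm 4 2 1 0 + nodeTerm 12 1 1 1 + nodeTerm (-4) 1 0 3 + nodeTerm 6 0 2 0
      + nodeTerm (-4) 0 1 2 + nodeTerm (-1) 0 0 4
  | 5 => nodeTerm 1 3 1 0 + nodeTerm 4 2 1 1 + nodeTerm (-6) 2 0 3 + nodeTerm 5 1 2 0
      + nodeTerm (-18) 1 1 2 + nodeTerm (-3) 1 0 4 + nodeTerm (-8) 0 2 1 + nodeTerm (-8) 0 1 3
  | 6 => nodeTerm (-4) 3 0 3 + nodeTerm 1 2 2 0 + nodeTerm (-16) 2 1 2 + nodeTerm (-3) 2 0 4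
      + nodeTerm (-12) 1 2 1 + nodeTerm (-12) 1 1 3 + nodeTerm (-2) 0 3 0 + nodeTerm (-4) 0 2 2
      + nodeTerm (-2) 0 1 4
  | 7 => nodeTerm (-1) 4 0 3 + nodeTerm (-4) 3 1 2 + nodeTerm (-1) 3 0 4 + nodeTerm (-4) 2 2 1
      + nodeTerm (-4) 2 1 3 + nodeTerm (-1) 1 3 0 + nodeTerm (-2) 1 2 2 + nodeTerm (-1) 1 1 4
  | _ => 0

lemma isHomogeneous_nodeTerm (a : ℂ) (i j k : ℕ) :
    (nodeTerm a i j k).IsHomogeneous (1 * i + 2 * j + 1 * k) :=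
  have h (i : Fin 3) := isHomogeneous_X ℂ i
  ((((h 0).add (h 1)).pow i).mul (((h 0).mul (h 1)).pow j) |>.mul ((h 2).pow k)).C_mul a

lemma isHomogeneous_nodeForm (j : ℕ) : (nodeForm j).IsHomogeneous j := by
  match j with
  | 0 | 1 | 2 | _ + 8 => exact isHomogeneous_zero ..
  | 3 | 4 | 5 | 6 | 7 =>
    rw [nodeForm]
    repeat' apply IsHomogeneous.add
    all_goals exact isHomogeneous_nodeTerm ..

lemma nowhereSingular_nodeForm : NowhereSingular (nodeForm 3) := by
  intro p hp
  by_contra! h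
  have h₀ := h 0
  have h₁ := h 1
  have h₂ := h 2
  simp [nodeForm, nodeTerm, Derivation.leibniz, Derivation.leibniz_pow, pderiv_X] at h₀ h₁ h₂
  have hp₀ : p 0 = 0 := by
    by_contra hp₀
    have e₁ : 2 * p 1 + p 0 + 2 * p 2 = 0 :=
      mul_left_cancel₀ hp₀ (by linear_combination h₁ / 4)
    have e₂ : p 1 * (p 0 - p 1) = 0 := by linear_combination h₀ / 4 - p 1 * e₁
    rcases mul_eq_zero.mp e₂ with e₂ | e₂ <;> grind
  have hp₂ : p 2 = 0 := by simpa [hp₀] using h₂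
  have hp₁ : p 1 = 0 := by simpa [hp₀, hp₂] using h₀
  refine hp (funext fun i => ?_)
  fin_cases i <;> assumption

lemma mul_mul_mul_mem_pow_three {A : Type*} [CommRing A] {I : Ideal A} {a b c : A} (ha : a ∈ I)
    (hb : b ∈ I) (hc : c ∈ I) (d : A) : a * b * c * d ∈ I ^ 3 := by
  rw [pow_succ, pow_two]
  exact Ideal.mul_mem_right _ _ (Ideal.mul_mem_mul (Ideal.mul_mem_mul ha hb) hc)

lemma exists_septicFamily_eq_at_vertex : ∃ U V : MvPolynomial (Fin 4) ℂ,
    eval ![0, 0, 0, 1] V = -1 ∧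
      septicFamily 0 1 = (X 0 + X 1) * (X 0 + X 2) * (X 1 + X 2) * U
        + (X 0 + X 1 + X 2) * (X 0 + X 1 + X 2) * (X 0 + X 1 + X 2) * V := by
  let e₁ : MvPolynomial (Fin 4) ℂ := X 0 + X 1 + X 2
  let e₂ : MvPolynomial (Fin 4) ℂ := X 0 * X 1 + X 0 * X 2 + X 1 * X 2
  let e₃ : MvPolynomial (Fin 4) ℂ := X 0 * X 1 * X 2
  refine ⟨-(X 3 ^ 4 + 4 * e₁ * X 3 ^ 3 + (4 * e₁ ^ 2 + 2 * e₂) * X 3 ^ 2 + 4 * e₁ * e₂ * X 3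
      + e₁ * e₃ + e₂ ^ 2), -(X 3 ^ 3 * (X 3 + e₁)), by simp [e₁], ?_⟩
  conv_lhs => rw [← aeval_X_left_apply (septicFamily 0 1)]
  rw [aeval_septicFamily _ rfl rfl rfl rfl]
  ring

lemma exists_septicFamily_eq_at_node : ∃ U₁ U₂ U₃ V : MvPolynomial (Fin 4) ℂ,
    eval ![1, 1, 0, -1] V = -1 ∧
      septicFamily 0 1 = (X 0 + X 3) * (X 1 + X 3) * ((X 0 + X 3) + (X 1 + X 3)) * U₁
        + (X 0 + X 3) * (X 1 + X 3) * X 2 * U₂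
        + (X 0 + X 3) * (X 1 + X 3) * (X 0 + X 3) * U₃ + X 2 * X 2 * X 2 * V := by
  let t : MvPolynomial (Fin 4) ℂ := -X 3
  let s : MvPolynomial (Fin 4) ℂ := (X 0 + X 3) + (X 1 + X 3)
  let p : MvPolynomial (Fin 4) ℂ := (X 0 + X 3) * (X 1 + X 3)
  let c : MvPolynomial (Fin 4) ℂ := X 2
  refine ⟨4 * t ^ 4 + 4 * s * t ^ 3 + 12 * c * t ^ 3
      + (s ^ 2 + 4 * s * c + 5 * p - 18 * c ^ 2) * t ^ 2
      + (s * p - 16 * s * c ^ 2 - 12 * p * c - 12 * c ^ 3) * t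
      - (4 * s ^ 2 * c ^ 2 + 4 * s * p * c + 4 * s * c ^ 3 + p ^ 2 + 2 * p * c ^ 2 + c ^ 4),
    8 * t ^ 4 - 4 * c * t ^ 3 - (8 * p + 8 * c ^ 2) * t ^ 2 - (4 * p * c + 2 * c ^ 3) * t,
    (X 1 + X 3) * (6 * t ^ 3 - 2 * p * t),
    -(t ^ 4 + (4 * s + c) * t ^ 3 + (6 * s ^ 2 + 3 * s * c) * t ^ 2
      + (4 * s ^ 3 + 3 * s ^ 2 * c) * t + s ^ 4 + s ^ 3 * c), by simp [s, c, t], ?_⟩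
  conv_lhs => rw [← aeval_X_left_apply (septicFamily 0 1)]
  rw [aeval_septicFamily _ rfl rfl rfl rfl]
  ring

lemma ordinaryTriplePointAt_vertex : OrdinaryTriplePointAt 7 (septicFamily 0 1) ![0, 0, 0, 1] := by
  have hF : septicFamily 0 1 = ∑ j ∈ Finset.range (7 + 1),
      (X 3) ^ (7 - j) * rename Fin.castSucc (vertexForm j) := by
    conv_lhs => rw [← aeval_X_left_apply (septicFamily 0 1)]
    rw [aeval_septicFamily _ rfl rfl rfl rfl]
    simp [Finset.sum_range_succ, vertexForm, map_ofNat]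
    ring
  obtain ⟨U, V, hV, hUV⟩ := exists_septicFamily_eq_at_vertex
  refine ⟨multAtLeast_of_mem_pow ?_, ⟨[0, 0, 0], rfl, ?_⟩, 1, by simp, by simp, vertexForm,
    isHomogeneous_vertexForm, ?_, nowhereSingular_vertexForm⟩
  · rw [hUV]
    refine add_mem ?_ ?_ <;> refine mul_mul_mul_mem_pow_three ?_ ?_ ?_ _ <;> simp
  · rw [hUV]
    simp [pderivList, Derivation.leibniz, pderiv_X, hV]
    norm_num
  · rw [← hF]
    simp [substMatrix, Matrix.one_apply]

lemma ordinaryTriplePointAt_node : OrdinaryTriplePointAt 7 (septicFamily 0 1) ![1, 1, 0, -1] := by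
  let B : Matrix (Fin 4) (Fin 4) ℂ := !![1, 0, 0, 1; 0, 1, 0, 1; 0, 0, 1, 0; 0, 0, 0, -1]
  have hF : substMatrix B (septicFamily 0 1) = ∑ j ∈ Finset.range (7 + 1),
      (X 3) ^ (7 - j) * rename Fin.castSucc (nodeForm j) := by
    rw [substMatrix, aeval_septicFamily _ rfl rfl rfl rfl]
    simp [Finset.sum_range_succ, nodeForm, nodeTerm, Fin.sum_univ_four, B, map_ofNat]
    ring
  obtain ⟨U₁, U₂, U₃, V, hV, hUV⟩ := exists_septicFamily_eq_at_node
  refine ⟨multAtLeast_of_mem_pow ?_, ⟨[2, 2, 2], rfl, ?_⟩, B, ?_, ?_, nodeForm,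
    isHomogeneous_nodeForm, hF, nowhereSingular_nodeForm⟩
  · rw [hUV]
    refine add_mem (add_mem (add_mem ?_ ?_) ?_) ?_ <;>
      refine mul_mul_mul_mem_pow_three ?_ ?_ ?_ _ <;> simp
  · rw [hUV]
    simp [pderivList, Derivation.leibniz, pderiv_X, hV]
    norm_num
  · simp [B, Matrix.det_succ_row_zero, Fin.sum_univ_succ]
  · ext i
    fin_cases i <;> simp [B, Matrix.mulVec, dotProduct, Fin.sum_univ_four]

/-- Integral representatives, with coordinate sum one, of the sixteen triple points of
`septicFamily 0 1`. -/
def tripleVectors : Finset (Fin 4 → ℤ) :=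
  Finset.univ.image (fun i => Pi.single i 1) ∪
    Finset.univ.image (fun g : Equiv.Perm (Fin 4) => ![-1, 0, 1, 1] ∘ g)

lemma card_tripleVectors : tripleVectors.card = 16 := by
  decide +kernel

lemma sum_tripleVectors {n : Fin 4 → ℤ} (hn : n ∈ tripleVectors) : ∑ i, n i = 1 := by
  revert n
  decide +kernel

lemma comp_mem_tripleVectors {n : Fin 4 → ℤ} (e : Equiv.Perm (Fin 4)) (hn : n ∈ tripleVectors) :
    n ∘ e ∈ tripleVectors := by
  simp only [tripleVectors, Finset.mem_union, Finset.mem_image, Finset.mem_univ, true_and]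
    at hn ⊢
  obtain ⟨i, rfl⟩ | ⟨g, rfl⟩ := hn
  · refine .inl ⟨e.symm i, funext fun j => ?_⟩
    simp [Pi.single_apply, Equiv.eq_symm_apply]
  · exact .inr ⟨g * e, rfl⟩

lemma exists_tripleVector_eq_comp {n : Fin 4 → ℤ} (hn : n ∈ tripleVectors) :
    ∃ e : Equiv.Perm (Fin 4), n = ![0, 0, 0, 1] ∘ e ∨ n = ![1, 1, 0, -1] ∘ e := by
  revert n
  decide +kernel

lemma cast_tripleVector_ne_zero {n : Fin 4 → ℤ} (hn : n ∈ tripleVectors) :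
    (fun i => (n i : ℂ)) ≠ 0 := by
  intro h
  have := sum_tripleVectors hn
  have h₀ (i : Fin 4) : n i = 0 := Int.cast_eq_zero.mp (congrFun h i)
  simp [h₀] at this

lemma ordinaryTriplePointAt_of_mem {n : Fin 4 → ℤ} (hn : n ∈ tripleVectors) :
    OrdinaryTriplePointAt 7 (septicFamily 0 1) (fun i => (n i : ℂ)) := by
  obtain ⟨e, rfl | rfl⟩ := exists_tripleVector_eq_comp hn
  · convert ordinaryTriplePointAt_vertex.comp_perm (rename_septicFamily e 0 1) using 1
    funext i
    simp only [Function.comp_apply]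
    generalize e i = j
    fin_cases j <;> simp
  · convert ordinaryTriplePointAt_node.comp_perm (rename_septicFamily e 0 1) using 1
    funext i
    simp only [Function.comp_apply]
    generalize e i = j
    fin_cases j <;> simp

lemma SingularAt.polarAt_eq_zero {v : Fin 4 → ℂ} (hv : SingularAt (septicFamily 0 1) v)
    (i : Fin 4) : polarAt (v 0) (v 1) (v 2) (v 3) (v i) = 0 := by
  rw [← eval_pderiv_septicFamily]
  exact hv [i] (by simp)

lemma exists_tripleVector_of_eq {v : Fin 4 → ℂ} (hv₀ : v ≠ 0)
    (hv : SingularAt (septicFamily 0 1) v) (h : v 0 = v 1) :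
    ∃ n ∈ tripleVectors, ∃ c : ℂ, v = c • fun i => (n i : ℂ) := by
  have hx := hv.polarAt_eq_zero 0
  have hz := hv.polarAt_eq_zero 2
  have hw := hv.polarAt_eq_zero 3
  rw [← h] at hx hz hw
  by_cases hzw : v 2 = v 3
  · rw [← hzw] at hx hz
    obtain ⟨h₀, h₂⟩ := polar_two_pairs hx hz
    refine absurd (funext fun i => ?_) hv₀
    fin_cases i <;> simp [← h, ← hzw, h₀, h₂]
  obtain ⟨h₁, h₂⟩ := polar_one_pair hzw hx hz hw
  rcases mul_eq_zero.mp h₁ with h₁ | h₁ <;> rcases h₂ with h₂ | h₂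
  · refine ⟨Pi.single 3 1, by decide +kernel, v 3, funext fun i => ?_⟩
    fin_cases i <;> simp [← h, h₁, h₂]
  · refine ⟨![1, 1, 0, -1], by decide +kernel, v 0, funext fun i => ?_⟩
    fin_cases i <;> simp [← h, h₁]
    linear_combination h₂ - h₁
  · refine ⟨Pi.single 2 1, by decide +kernel, v 2, funext fun i => ?_⟩
    fin_cases i <;> simp [← h, h₁, h₂]
  · refine ⟨![1, 1, -1, 0], by decide +kernel, v 0, funext fun i => ?_⟩
    fin_cases i <;> simp [← h, h₁]
    linear_combination h₂ - h₁

lemma exists_tripleVector_of_singularAt {v : Fin 4 → ℂ} (hv₀ : v ≠ 0)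
    (hv : SingularAt (septicFamily 0 1) v) :
    ∃ n ∈ tripleVectors, ∃ c : ℂ, v = c • fun i => (n i : ℂ) := by
  obtain ⟨i, j, hij, h⟩ : ∃ i j, i ≠ j ∧ v i = v j := by
    by_contra! H
    exact not_four_distinct_polar_roots (H 0 1 (by decide)) (H 0 2 (by decide)) (H 0 3 (by decide))
      (H 1 2 (by decide)) (H 1 3 (by decide)) (H 2 3 (by decide)) (hv.polarAt_eq_zero 0)
      (hv.polarAt_eq_zero 1) (hv.polarAt_eq_zero 2) (hv.polarAt_eq_zero 3)
  obtain ⟨e, rfl, rfl⟩ : ∃ e : Equiv.Perm (Fin 4), e 0 = i ∧ e 1 = j := by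
    clear h
    decide +kernel +revert
  have hve : v ∘ e ≠ 0 := fun H => hv₀ <| by
    ext k
    simpa using congrFun H (e.symm k)
  obtain ⟨n, hn, c, hc⟩ := exists_tripleVector_of_eq hve
    (MultAtLeast.comp_perm (rename_septicFamily e 0 1) hv) h
  refine ⟨n ∘ e.symm, comp_mem_tripleVectors _ hn, c, funext fun k => ?_⟩
  simpa using congrFun hc (e.symm k)

/-- there are `μ, ν ∈ ℂ` such that the `S₄`-symmetric septic surface
`{F_{μ,ν} = 0} ⊂ ℙ³(ℂ)` has exactly 16 singular points, all of them ordinary triple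
points, namely the four coordinate vertices together with the twelve points of the orbit
of `(−ν : μ : ν : ν)` under permutation of the coordinates. -/
theorem septic_with_sixteen_triple_points :
    ∃ μ ν : ℂ,
      let F := septicFamily μ ν
      let T : Set (Projectivization ℂ (Fin 4 → ℂ)) :=
        {P | (∃ i : Fin 4, ∃ h : (Pi.single i 1 : Fin 4 → ℂ) ≠ 0,
                P = Projectivization.mk ℂ (Pi.single i 1) h) ∨
             (∃ g : Equiv.Perm (Fin 4), ∃ h : (fun j => ![-ν, μ, ν, ν] (g j)) ≠ 0,
                P = Projectivization.mk ℂ (fun j => ![-ν, μ, ν, ν] (g j)) h)}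
      F ≠ 0 ∧ F.IsHomogeneous 7 ∧
      SingSet F = T ∧ T.ncard = 16 ∧
      ∀ P ∈ T, OrdinaryTriplePointAt 7 F P.rep := by
  refine ⟨0, 1, ?_⟩
  intro F T
  have hT (P : Projectivization ℂ (Fin 4 → ℂ)) :
      P ∈ T ↔ ∃ n ∈ tripleVectors, ∃ h, P = Projectivization.mk ℂ (fun i => (n i : ℂ)) h := by
    have hs (i : Fin 4) : (fun j => ((Pi.single i 1 : Fin 4 → ℤ) j : ℂ)) = Pi.single i 1 := by
      ext j
      simp [Pi.single_apply]
    have hg (g : Equiv.Perm (Fin 4)) : (fun j => (((![-1, 0, 1, 1] : Fin 4 → ℤ) ∘ g) j : ℂ)) =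
        fun j => (![-1, 0, 1, 1] : Fin 4 → ℂ) (g j) := by
      ext j
      simp only [Function.comp_apply]
      generalize g j = k
      fin_cases k <;> simp
    simp only [tripleVectors, Finset.mem_union, Finset.mem_image, Finset.mem_univ, true_and, T,
      Set.mem_ofPred_eq, or_and_right, exists_or, exists_exists_eq_and, hs, hg]
  have hF : F.IsHomogeneous 7 := isHomogeneous_septicFamily 0 1
  have hOTP : ∀ P ∈ T, OrdinaryTriplePointAt 7 F P.rep := by
    intro P hP
    obtain ⟨n, hn, h, rfl⟩ := (hT P).mp hP
    obtain ⟨a, ha⟩ := Projectivization.exists_smul_eq_mk_rep ℂ _ h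
    rw [← ha]
    exact (ordinaryTriplePointAt_of_mem hn).smul a.ne_zero hF
  refine ⟨?_, hF, ?_, ?_, hOTP⟩
  · intro h
    obtain ⟨_, ⟨l, _, hl⟩, _⟩ := ordinaryTriplePointAt_vertex
    rw [show septicFamily 0 1 = 0 from h] at hl
    rw [pderivList, List.foldl_fixed' (fun i => map_zero _)] at hl
    exact hl (map_zero _)
  · ext P
    refine ⟨fun hP => ?_, fun hP l hl => (hOTP P hP).1 l (by omega)⟩
    obtain ⟨n, hn, c, hc⟩ := exists_tripleVector_of_singularAt P.rep_nonzero hP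
    refine (hT P).mpr ⟨n, hn, cast_tripleVector_ne_zero hn, ?_⟩
    rw [← P.mk_rep, Projectivization.mk_eq_mk_iff']
    exact ⟨c, hc.symm⟩
  · rw [← card_tripleVectors, ← Set.ncard_coe_finset]
    symm
    refine Set.ncard_congr
      (fun n hn => Projectivization.mk ℂ (fun i => (n i : ℂ)) (cast_tripleVector_ne_zero hn))
      (fun n hn => (hT _).mpr ⟨n, hn, _, rfl⟩) (fun n m hn hm h => ?_) fun P hP => ?_
    · obtain ⟨a, ha⟩ := (Projectivization.mk_eq_mk_iff' ..).mp h
      have hsum {k : Fin 4 → ℤ} (hk : k ∈ tripleVectors) : ∑ i, (k i : ℂ) = 1 := by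
        exact_mod_cast sum_tripleVectors hk
      have ha₁ : a = 1 := by
        have := congrArg (fun v => ∑ i, v i) ha
        simpa [← Finset.mul_sum, hsum hn, hsum hm] using this
      ext i
      have := congrFun ha i
      rw [ha₁, one_smul] at this
      exact_mod_cast this.symm
    · obtain ⟨n, hn, h, rfl⟩ := (hT P).mp hP
      exact ⟨n, hn, rfl⟩
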